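/- arXiv:0902.4899 — 2 statements merged into one kernel-verified Lean document; each statement's English description precedes it below -/
import Mathlib

section
/- For n = 3 and every m ≥ 2, the lower central series of the free algebra satisfies L_{m+1} = Σ_{i} [x_i, L_m] + Σ_{i ≤ j} [x_i x_j, L_m] + L_{m+2}; i.e. B_{m+1} = Σ_i [x_i, B_m] + Σ_{i≤j} [x_i x_j, B_m]. -/
/-- The lower central series of the free algebra `A_n = FreeAlgebra ℂ (Fin n)`,
as a chain of `ℂ`-subspaces: `lcs n 1 = A`, `lcs n (m+1) = span {[a,w] : a ∈ A, w ∈ lcs n m}`.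
(The value at `0` is junk, set to `⊤`.) -/
def lcs (n : ℕ) : ℕ → Submodule ℂ (FreeAlgebra ℂ (Fin n))
  | 0 => ⊤
  | 1 => ⊤
  | m + 2 => Submodule.span ℂ
      {y | ∃ a w, w ∈ lcs n (m + 1) ∧ y = a * w - w * a}

/-- For `g ∈ A` and a `ℂ`-subspace `V ⊆ A`, `[g, V] = span {[g,w] : w ∈ V}`. -/
def brS {n : ℕ} (g : FreeAlgebra ℂ (Fin n)) (V : Submodule ℂ (FreeAlgebra ℂ (Fin n))) :
    Submodule ℂ (FreeAlgebra ℂ (Fin n)) :=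
  Submodule.span ℂ {y | ∃ w ∈ V, y = g * w - w * g}

section LowerCentralSeries

variable {n : ℕ}

attribute [local instance] LieRing.ofAssociativeRing

local notation "A" => FreeAlgebra ℂ (Fin n)

theorem lie_mem_of_mem_span {s : Set A} {P : Submodule ℂ A} {a u : A}
    (h : ∀ x ∈ s, ⁅a, x⁆ ∈ P) (hu : u ∈ Submodule.span ℂ s) : ⁅a, u⁆ ∈ P := by
  induction hu using Submodule.span_induction with
  | mem x hx => exact h x hx
  | zero => simp
  | add x y _ _ hx hy => rw [lie_add]; exact P.add_mem hx hy
  | smul c x _ hx => rw [lie_smul]; exact P.smul_mem c hx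

theorem mem_lie_comm {P : Submodule ℂ A} {a b : A} (h : ⁅a, b⁆ ∈ P) : ⁅b, a⁆ ∈ P := by
  rw [← lie_skew]; exact P.neg_mem h

theorem lie_mem_of_mem_span_left {s : Set A} {P : Submodule ℂ A} {a u : A}
    (h : ∀ x ∈ s, ⁅x, a⁆ ∈ P) (hu : u ∈ Submodule.span ℂ s) : ⁅u, a⁆ ∈ P :=
  mem_lie_comm (lie_mem_of_mem_span (fun x hx => mem_lie_comm (h x hx)) hu)

theorem lcs_one : lcs n 1 = ⊤ := rfl

theorem lie_mem_lcs_succ {k : ℕ} (hk : 1 ≤ k) (a : A) {w : A} (hw : w ∈ lcs n k) :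
    ⁅a, w⁆ ∈ lcs n (k + 1) := by
  obtain ⟨k, rfl⟩ : ∃ l, k = l + 1 := ⟨k - 1, by omega⟩
  exact Submodule.subset_span ⟨a, w, hw, Ring.lie_def a w⟩

theorem lcs_succ_le {k : ℕ} (hk : 1 ≤ k) {P : Submodule ℂ A}
    (h : ∀ a : A, ∀ w ∈ lcs n k, ⁅a, w⁆ ∈ P) : lcs n (k + 1) ≤ P := by
  obtain ⟨k, rfl⟩ : ∃ l, k = l + 1 := ⟨k - 1, by omega⟩
  refine Submodule.span_le.2 ?_
  rintro _ ⟨a, w, hw, rfl⟩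
  exact h a w hw

theorem lie_mem_lcs_two (a b : A) : ⁅a, b⁆ ∈ lcs n 2 :=
  lie_mem_lcs_succ le_rfl a (w := b) (by simp [lcs_one])

theorem lcs_succ_le_self (k : ℕ) : lcs n (k + 1) ≤ lcs n k := by
  induction k with
  | zero => exact le_top
  | succ k ih =>
    rcases Nat.eq_zero_or_pos k with rfl | hk
    · exact le_top
    · exact lcs_succ_le (by omega) fun a w hw => lie_mem_lcs_succ hk a (ih hw)

theorem lcs_antitone : Antitone (lcs n) := antitone_nat_of_succ_le lcs_succ_le_self

theorem lie_mem_lcs_add {i k : ℕ} (hi : 1 ≤ i) (hk : 1 ≤ k) {u w : A} (hu : u ∈ lcs n i)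
    (hw : w ∈ lcs n k) : ⁅u, w⁆ ∈ lcs n (i + k) := by
  induction i, hi using Nat.le_induction generalizing k u w with
  | base => rw [add_comm]; exact lie_mem_lcs_succ hk u hw
  | succ i hi ih =>
    have : lcs n (i + 1) ≤ (lcs n (i + 1 + k)).comap
        (-(LieAlgebra.ad ℂ A w : A →ₗ[ℂ] A)) := by
      refine lcs_succ_le hi fun a v hv => ?_
      have e : (-(LieAlgebra.ad ℂ A w : A →ₗ[ℂ] A)) ⁅a, v⁆ = ⁅a, ⁅v, w⁆⁆ - ⁅v, ⁅a, w⁆⁆ := by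
        simp only [LinearMap.neg_apply, LieAlgebra.ad_apply, Ring.lie_def]
        noncomm_ring
      rw [Submodule.mem_comap, e]
      refine Submodule.sub_mem _ ?_ ?_
      · have := lie_mem_lcs_succ (by omega) a (ih hk hv hw)
        rwa [show i + 1 + k = i + k + 1 by omega]
      · have := ih (by omega) hv (lie_mem_lcs_succ hk a hw)
        rwa [show i + 1 + k = i + (k + 1) by omega]
    have h := this hu
    rw [Submodule.mem_comap] at h
    simpa using h

/-- The two-sided ideal generated by `lcs n k`, as a subspace. -/
def lcsIdeal (n k : ℕ) : Submodule ℂ (FreeAlgebra ℂ (Fin n)) :=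
  Submodule.span ℂ {y | ∃ p w r, w ∈ lcs n k ∧ y = p * w * r}

theorem mul_mul_mem_lcsIdeal {k : ℕ} (p r : A) {w : A} (hw : w ∈ lcs n k) :
    p * w * r ∈ lcsIdeal n k := Submodule.subset_span ⟨p, w, r, hw, rfl⟩

theorem lcs_le_lcsIdeal (k : ℕ) : lcs n k ≤ lcsIdeal n k := fun w hw => by
  simpa using mul_mul_mem_lcsIdeal 1 1 hw

theorem mul_mem_lcsIdeal_left {k : ℕ} (a : A) {u : A} (hu : u ∈ lcsIdeal n k) :
    a * u ∈ lcsIdeal n k := by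
  induction hu using Submodule.span_induction with
  | mem x hx =>
    obtain ⟨p, w, r, hw, rfl⟩ := hx
    simpa only [mul_assoc] using mul_mul_mem_lcsIdeal (a * p) r hw
  | zero => simp
  | add x y _ _ hx hy => rw [mul_add]; exact Submodule.add_mem _ hx hy
  | smul c x _ hx => rw [mul_smul_comm]; exact Submodule.smul_mem _ c hx

theorem mul_mem_lcsIdeal_right {k : ℕ} (a : A) {u : A} (hu : u ∈ lcsIdeal n k) :
    u * a ∈ lcsIdeal n k := by
  induction hu using Submodule.span_induction with
  | mem x hx =>
    obtain ⟨p, w, r, hw, rfl⟩ := hx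
    simpa only [mul_assoc] using mul_mul_mem_lcsIdeal p (r * a) hw
  | zero => simp
  | add x y _ _ hx hy => rw [add_mul]; exact Submodule.add_mem _ hx hy
  | smul c x _ hx => rw [smul_mul_assoc]; exact Submodule.smul_mem _ c hx

theorem lie_mem_lcsIdeal {k : ℕ} (a : A) {u : A} (hu : u ∈ lcsIdeal n k) :
    ⁅a, u⁆ ∈ lcsIdeal n k :=
  Submodule.sub_mem _ (mul_mem_lcsIdeal_left a hu) (mul_mem_lcsIdeal_right a hu)

theorem three_nsmul_lie_mul_lie_lie (a b c d w : A) :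
    3 • ⁅b, a * ⁅c, ⁅d, w⁆⁆⁆ =
      (⁅b * a, ⁅c, ⁅d, w⁆⁆⁆
        + ⁅c, ⁅b, ⁅a, d * w⁆⁆⁆
        + ⁅c, ⁅a, ⁅d, b * w⁆⁆⁆
        + ⁅c, ⁅d, ⁅b, w * a⁆⁆⁆
        + 2 • ⁅b, ⁅a * c, ⁅d, w⁆⁆⁆
        + 2 • ⁅d, ⁅a, ⁅c, w * b⁆⁆⁆
        + 2 • ⁅d * c, ⁅a, ⁅b, w⁆⁆⁆
        + 2 • ⁅d, ⁅c, ⁅b, a * w⁆⁆⁆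
        + ⁅d, ⁅b, ⁅a * c, w⁆⁆⁆
        + ⁅b, ⁅a * d, ⁅c, w⁆⁆⁆
        + ⁅b * d, ⁅c, ⁅a, w⁆⁆⁆
        + ⁅a * d, ⁅b, ⁅c, w⁆⁆⁆
        + ⁅d, ⁅a * c, ⁅b, w⁆⁆⁆
        + ⁅c * a, ⁅d, ⁅b, w⁆⁆⁆
        + ⁅a, ⁅c, ⁅b, d * w⁆⁆⁆)
      - (⁅c * b, ⁅a, ⁅d, w⁆⁆⁆
        + 2 • ⁅c, ⁅a * d, ⁅b, w⁆⁆⁆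
        + 2 • ⁅d, ⁅c * a, ⁅b, w⁆⁆⁆
        + ⁅d * c, ⁅b, ⁅a, w⁆⁆⁆
        + 2 • ⁅d, ⁅b, ⁅c, w * a⁆⁆⁆
        + ⁅d * b, ⁅a, ⁅c, w⁆⁆⁆
        + ⁅b, ⁅a, ⁅d, c * w⁆⁆⁆
        + ⁅b, ⁅d, ⁅c, a * w⁆⁆⁆
        + ⁅b, ⁅c, ⁅a, w * d⁆⁆⁆
        + ⁅a, ⁅d, ⁅b, c * w⁆⁆⁆
        + ⁅d, ⁅c, ⁅b * a, w⁆⁆⁆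
        + ⁅d, ⁅a, ⁅c * b, w⁆⁆⁆
        + ⁅a, ⁅b, ⁅c, w * d⁆⁆⁆
        + ⁅a, ⁅c, ⁅b * d, w⁆⁆⁆) := by
  simp only [Ring.lie_def]
  noncomm_ring

theorem lcs_succ_succ_le {k : ℕ} (hk : 1 ≤ k) {P : Submodule ℂ A}
    (h : ∀ a b : A, ∀ w ∈ lcs n k, ⁅a, ⁅b, w⁆⁆ ∈ P) : lcs n (k + 2) ≤ P := by
  refine lcs_succ_le (by omega) fun a w hw => ?_
  have : lcs n (k + 1) ≤ P.comap (LieAlgebra.ad ℂ A a : A →ₗ[ℂ] A) :=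
    lcs_succ_le hk fun b w hw => by simpa using h a b w hw
  simpa using this hw

theorem nsmul_mem_iff {P : Submodule ℂ A} {k : ℕ} (hk : k ≠ 0) {x : A} : k • x ∈ P ↔ x ∈ P := by
  rw [← Nat.cast_smul_eq_nsmul ℂ]
  exact P.smul_mem_iff (by exact_mod_cast hk)

theorem lie_mem_lcs_of_mem_lcsIdeal (t : ℕ) (a : A) {u : A} (hu : u ∈ lcsIdeal n (2 * t + 1)) :
    ⁅a, u⁆ ∈ lcs n (2 * t + 2) := by
  induction t generalizing a u with
  | zero => exact lie_mem_lcs_two a u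
  | succ t ih =>
    have triple (a b c : A) {w : A} (hw : w ∈ lcsIdeal n (2 * t + 1)) :
        ⁅a, ⁅b, ⁅c, w⁆⁆⁆ ∈ lcs n (2 * t + 4) :=
      lie_mem_lcs_succ (by omega) _ (lie_mem_lcs_succ (by omega) _ (ih c hw))
    have key (a b c d : A) {w : A} (hw : w ∈ lcsIdeal n (2 * t + 1)) :
        ⁅b, a * ⁅c, ⁅d, w⁆⁆⁆ ∈ lcs n (2 * t + 4) := by
      rw [← nsmul_mem_iff three_ne_zero, three_nsmul_lie_mul_lie_lie]
      refine Submodule.sub_mem _ ?_ ?_ <;>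
      repeat' first
        | with_reducible apply Submodule.add_mem
        | with_reducible apply Submodule.smul_of_tower_mem
        | with_reducible apply triple
        | with_reducible exact mul_mem_lcsIdeal_left _ hw
        | with_reducible exact mul_mem_lcsIdeal_right _ hw
        | with_reducible exact hw
    rw [show 2 * (t + 1) + 2 = 2 * t + 4 by ring]
    refine lie_mem_of_mem_span ?_ hu
    rintro _ ⟨p, v, r, hv, rfl⟩
    have : lcs n (2 * t + 1 + 2) ≤ (lcs n (2 * t + 4)).comap
        ((LieAlgebra.ad ℂ A a : A →ₗ[ℂ] A) ∘ₗ LinearMap.mulLeftRight ℂ (p, r)) := by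
      refine lcs_succ_succ_le (by omega) fun c d w hw => ?_
      have hw' := lcs_le_lcsIdeal _ hw
      have e : p * ⁅c, ⁅d, w⁆⁆ * r = p * r * ⁅c, ⁅d, w⁆⁆ - p * ⁅r, ⁅c, ⁅d, w⁆⁆⁆ := by
        simp only [Ring.lie_def]
        noncomm_ring
      simp only [Submodule.mem_comap, LinearMap.comp_apply, LinearMap.mulLeftRight_apply,
        LieAlgebra.ad_apply, e, lie_sub]
      exact Submodule.sub_mem _ (key _ _ _ _ hw') (key _ _ _ _ (lie_mem_lcsIdeal _ hw'))
    simpa using this hv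

theorem lie_mem_lcs_add_of_mem_lcsIdeal (t : ℕ) {i : ℕ} (hi : 1 ≤ i) {v u : A}
    (hv : v ∈ lcs n i) (hu : u ∈ lcsIdeal n (2 * t + 1)) : ⁅v, u⁆ ∈ lcs n (i + (2 * t + 1)) := by
  induction i, hi using Nat.le_induction generalizing v u with
  | base => rw [add_comm]; exact lie_mem_lcs_of_mem_lcsIdeal t v hu
  | succ i hi ih =>
    have : lcs n (i + 1) ≤ (lcs n (i + 1 + (2 * t + 1))).comap
        (-(LieAlgebra.ad ℂ A u : A →ₗ[ℂ] A)) := by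
      refine lcs_succ_le hi fun a v hv => ?_
      have e : (-(LieAlgebra.ad ℂ A u : A →ₗ[ℂ] A)) ⁅a, v⁆ = ⁅a, ⁅v, u⁆⁆ - ⁅v, ⁅a, u⁆⁆ := by
        simp only [LinearMap.neg_apply, LieAlgebra.ad_apply, Ring.lie_def]
        noncomm_ring
      rw [Submodule.mem_comap, e, show i + 1 + (2 * t + 1) = i + (2 * t + 1) + 1 by omega]
      refine Submodule.sub_mem _ (lie_mem_lcs_succ (by omega) a (ih hv hu)) ?_
      exact lie_mem_lcs_add hi (by omega) hv (lie_mem_lcs_of_mem_lcsIdeal t a hu)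
    have h := this hv
    rw [Submodule.mem_comap] at h
    simpa using h

/-- The span of the brackets of the generators with the elements of a subspace. -/
def genLie (M : Submodule ℂ A) : Submodule ℂ A :=
  Submodule.span ℂ {y | ∃ i : Fin n, ∃ u ∈ M, y = ⁅FreeAlgebra.ι ℂ i, u⁆}

theorem lie_mem_genLie {M : Submodule ℂ A} (hl : ∀ a, ∀ u ∈ M, a * u ∈ M)
    (hr : ∀ a, ∀ u ∈ M, u * a ∈ M) (a : A) {u : A} (hu : u ∈ M) : ⁅a, u⁆ ∈ genLie M := by
  induction a using FreeAlgebra.induction generalizing u with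
  | grade0 r =>
    have : ⁅algebraMap ℂ A r, u⁆ = 0 := by rw [Ring.lie_def, Algebra.commutes, sub_self]
    rw [this]
    exact Submodule.zero_mem _
  | grade1 i => exact Submodule.subset_span ⟨i, u, hu, rfl⟩
  | mul a b ha hb =>
    have : ⁅a * b, u⁆ = ⁅a, b * u⁆ + ⁅b, u * a⁆ := by
      simp only [Ring.lie_def]
      noncomm_ring
    rw [this]
    exact Submodule.add_mem _ (ha (hl b u hu)) (hb (hr a u hu))
  | add a b ha hb => rw [add_lie]; exact Submodule.add_mem _ (ha hu) (hb hu)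

theorem lcs_le_genLie_lcsIdeal {k : ℕ} (hk : 1 ≤ k) : lcs n (k + 1) ≤ genLie (lcsIdeal n k) :=
  lcs_succ_le hk fun a _ hw => lie_mem_genLie (fun a _ => mul_mem_lcsIdeal_left a)
    (fun a _ => mul_mem_lcsIdeal_right a) a (lcs_le_lcsIdeal _ hw)

/-- The span of the generators. -/
def genSpan (n : ℕ) : Submodule ℂ (FreeAlgebra ℂ (Fin n)) :=
  Submodule.span ℂ (Set.range (FreeAlgebra.ι ℂ))

theorem ι_mem_genSpan (i : Fin n) : FreeAlgebra.ι ℂ i ∈ genSpan n :=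
  Submodule.subset_span ⟨i, rfl⟩

theorem mem_of_forall_sum_pow_smul_mem {E : Type*} [AddCommGroup E] [Module ℂ E]
    {W : Submodule ℂ E} {N : ℕ} {c : ℕ → E}
    (h : ∀ t : ℂ, ∑ i ∈ Finset.range N, t ^ i • c i ∈ W) {i : ℕ} (hi : i < N) : c i ∈ W := by
  rw [← Submodule.Quotient.mk_eq_zero, ← Module.forall_dual_apply_eq_zero_iff ℂ]
  intro φ
  let p : Polynomial ℂ :=
    ∑ i ∈ Finset.range N, Polynomial.C (φ (Submodule.Quotient.mk (c i))) * Polynomial.X ^ i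
  have hp : p = 0 := by
    refine Polynomial.funext fun t => ?_
    have := congrArg φ ((Submodule.Quotient.mk_eq_zero W).2 (h t))
    simp only [← Submodule.mkQ_apply, map_sum, map_smul, map_zero] at this
    simp only [p, Polynomial.eval_finsetSum, Polynomial.eval_mul, Polynomial.eval_C,
      Polynomial.eval_pow, Polynomial.eval_X, Polynomial.eval_zero]
    rw [← this]
    exact Finset.sum_congr rfl fun i _ => by simp [mul_comm]
  have := congrArg (Polynomial.coeff · i) hp
  simpa [p, Polynomial.finsetSum_coeff, Polynomial.coeff_C_mul, Polynomial.coeff_X_pow, hi]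
    using this

theorem lie_mem_lcsIdeal_two (a b : A) : ⁅a, b⁆ ∈ lcsIdeal n 2 :=
  lcs_le_lcsIdeal _ (lie_mem_lcs_two a b)

theorem coeff_one_add_mul_X_pow_sub_mem (l y : A) (k : ℕ) :
    ((Polynomial.C l + Polynomial.C y * Polynomial.X) ^ (k + 1)).coeff 1
      - (k + 1) • (l ^ k * y) ∈ lcsIdeal n 2 := by
  induction k with
  | zero => simp
  | succ k ih =>
    have h0 : ((Polynomial.C l + Polynomial.C y * Polynomial.X) ^ (k + 1)).coeff 0 =
        l ^ (k + 1) := by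
      rw [← Polynomial.constantCoeff_apply, map_pow]
      simp
    rw [pow_succ', Polynomial.mul_coeff_one, h0]
    set c := ((Polynomial.C l + Polynomial.C y * Polynomial.X) ^ (k + 1)).coeff 1
    have h1 : (Polynomial.C l + Polynomial.C y * Polynomial.X).coeff 0 = l := by simp
    have h2 : (Polynomial.C l + Polynomial.C y * Polynomial.X).coeff 1 = y := by
      simp [Polynomial.coeff_C]
    have e : l * c + y * l ^ (k + 1) - (k + 1 + 1) • (l ^ (k + 1) * y) =
        l * (c - (k + 1) • (l ^ k * y)) + ⁅y, l ^ (k + 1)⁆ := by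
      rw [Ring.lie_def, mul_sub, mul_smul_comm, ← mul_assoc, ← pow_succ', succ_nsmul _ (k + 1)]
      abel
    rw [h1, h2, e]
    exact Submodule.add_mem _ (mul_mem_lcsIdeal_left _ ih) (lie_mem_lcsIdeal_two _ _)

/-- The span of the powers of linear forms, together with the ideal generated by `lcs n 2`. -/
def powSpan (n : ℕ) : Submodule ℂ (FreeAlgebra ℂ (Fin n)) :=
  Submodule.span ℂ {y | ∃ l ∈ genSpan n, ∃ k : ℕ, y = l ^ k} ⊔ lcsIdeal n 2

theorem pow_mem_powSpan {l : A} (hl : l ∈ genSpan n) (k : ℕ) : l ^ k ∈ powSpan n :=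
  Submodule.mem_sup_left (Submodule.subset_span ⟨l, hl, k, rfl⟩)

theorem pow_mul_mem_powSpan {l y : A} (hl : l ∈ genSpan n) (hy : y ∈ genSpan n) (k : ℕ) :
    l ^ k * y ∈ powSpan n := by
  set p := (Polynomial.C l + Polynomial.C y * Polynomial.X) ^ (k + 1) with hp
  have key : p.coeff 1 ∈ powSpan n := by
    refine mem_of_forall_sum_pow_smul_mem (N := p.natDegree + 2) (fun t => ?_) (by omega)
    let ev : Polynomial A →+* A :=
      Polynomial.eval₂RingHom' (RingHom.id A) (algebraMap ℂ A t)
        fun a => (Algebra.commutes t a).symm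
    have h1 : ev p = (l + t • y) ^ (k + 1) := by
      have hC (a : A) : ev (Polynomial.C a) = a := Polynomial.eval₂_C _ _
      have hX : ev Polynomial.X = algebraMap ℂ A t := Polynomial.eval₂_X _ _
      rw [hp, map_pow, map_add, map_mul, hC, hC, hX, ← Algebra.commutes, Algebra.smul_def]
    have h2 : ev p = ∑ i ∈ Finset.range (p.natDegree + 2), t ^ i • p.coeff i := by
      change p.eval₂ (RingHom.id A) (algebraMap ℂ A t) = _
      rw [Polynomial.eval₂_eq_sum_range' _ (show p.natDegree < p.natDegree + 2 by omega)]
      refine Finset.sum_congr rfl fun i _ => ?_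
      rw [← map_pow, RingHom.id_apply, ← Algebra.commutes, Algebra.smul_def]
    rw [← h2, h1]
    exact pow_mem_powSpan (Submodule.add_mem _ hl (Submodule.smul_mem _ _ hy)) _
  rw [← nsmul_mem_iff (Nat.succ_ne_zero k)]
  have := Submodule.sub_mem _ key
    (Submodule.mem_sup_right (coeff_one_add_mul_X_pow_sub_mem l y k) : _ ∈ powSpan n)
  rwa [sub_sub_cancel] at this

theorem mem_powSpan (a : A) : a ∈ powSpan n := by
  have key : ∀ w ∈ powSpan n, w * a ∈ powSpan n := by
    induction a using FreeAlgebra.induction with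
    | grade0 r =>
      intro w hw
      rw [← Algebra.commutes, ← Algebra.smul_def]
      exact Submodule.smul_mem _ _ hw
    | grade1 i =>
      intro w hw
      have : powSpan n ≤ (powSpan n).comap (LinearMap.mulRight ℂ (FreeAlgebra.ι ℂ i)) := by
        refine sup_le (Submodule.span_le.2 ?_) fun u hu => ?_
        · rintro _ ⟨l, hl, k, rfl⟩
          exact pow_mul_mem_powSpan hl (ι_mem_genSpan i) k
        · exact Submodule.mem_sup_right (mul_mem_lcsIdeal_right _ hu)
      exact this hw
    | mul a b ha hb => exact fun w hw => by rw [← mul_assoc]; exact hb _ (ha w hw)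
    | add a b ha hb => exact fun w hw => by rw [mul_add]; exact add_mem (ha w hw) (hb w hw)
  simpa using key 1 (pow_mem_powSpan (Submodule.zero_mem _) 0)

/-- The linear map `y ↦ l * y + y * l`. -/
noncomputable def antiMul (l : A) : Module.End ℂ A :=
  LinearMap.mulLeft ℂ l + LinearMap.mulRight ℂ l

theorem antiMul_apply (l y : A) : antiMul l y = l * y + y * l := rfl

theorem antiMul_pow_succ (l y : A) (k : ℕ) :
    (antiMul l ^ (k + 1)) y = antiMul l ((antiMul l ^ k) y) := by
  rw [pow_succ']; rfl

theorem antiMul_pow_succ' (l y : A) (k : ℕ) :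
    (antiMul l ^ (k + 1)) y = (antiMul l ^ k) (antiMul l y) := by
  rw [pow_succ]; rfl

theorem lie_antiMul (l y : A) : ⁅l, antiMul l y⁆ = antiMul l ⁅l, y⁆ := by
  simp only [antiMul_apply, Ring.lie_def]
  noncomm_ring

theorem lie_antiMul_pow (l y : A) (k : ℕ) :
    ⁅l, (antiMul l ^ k) y⁆ = (antiMul l ^ k) ⁅l, y⁆ := by
  induction k with
  | zero => rfl
  | succ k ih => rw [antiMul_pow_succ, antiMul_pow_succ, lie_antiMul, ih]

theorem lie_antiMul_antiMul (l w u : A) :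
    ⁅antiMul l (antiMul l w), u⁆ =
      2 • ⁅antiMul l w, antiMul l u⁆ - ⁅w, antiMul l (antiMul l u)⁆ + ⁅l, ⁅l, ⁅w, u⁆⁆⁆ := by
  simp only [antiMul_apply, Ring.lie_def]
  noncomm_ring

theorem antiMul_pow_sub_mem_lcs_two (l y : A) (k : ℕ) :
    (antiMul l ^ k) y - (2 : ℂ) ^ k • (l ^ k * y) ∈ lcs n 2 := by
  induction k generalizing y with
  | zero => simp
  | succ k ih =>
    have e : (antiMul l ^ (k + 1)) y - (2 : ℂ) ^ (k + 1) • (l ^ (k + 1) * y) =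
        ((antiMul l ^ k) (antiMul l y) - (2 : ℂ) ^ k • (l ^ k * antiMul l y))
          + (2 : ℂ) ^ k • ⁅l ^ k * y, l⁆ := by
      have h : l * l ^ k = l ^ k * l := (pow_mul_comm' l k).symm
      simp only [antiMul_pow_succ', antiMul_apply, Ring.lie_def, ← mul_assoc, mul_add, h,
        pow_succ l]
      module
    rw [e]
    exact Submodule.add_mem _ (ih _) (Submodule.smul_mem _ _ (lie_mem_lcs_two _ _))

theorem exists_pow_lie_eq (l y : A) (k : ℕ) : ∃ z, ⁅l ^ (k + 1), y⁆ = ⁅l, z⁆ := by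
  induction k with
  | zero => exact ⟨y, by simp⟩
  | succ k ih =>
    obtain ⟨z, hz⟩ := ih
    refine ⟨l * z + y * l ^ (k + 1), ?_⟩
    have : ⁅l ^ (k + 2), y⁆ = l * ⁅l ^ (k + 1), y⁆ + ⁅l, y⁆ * l ^ (k + 1) := by
      simp only [Ring.lie_def, pow_succ' l (k + 1)]
      noncomm_ring
    have h : l * l ^ (k + 1) = l ^ (k + 1) * l := (pow_mul_comm' l _).symm
    rw [this, hz]
    simp only [Ring.lie_def, mul_add, add_mul, mul_sub, sub_mul, mul_assoc, h]
    abel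

theorem exists_pow_antiMul_sub_eq (l y : A) (k : ℕ) :
    ∃ z, (2 : ℂ) ^ k • (l ^ (k + 1) * y + y * l ^ (k + 1)) - (antiMul l ^ (k + 1)) y =
      ⁅l, ⁅l, z⁆⁆ := by
  induction k with
  | zero => exact ⟨0, by simp [antiMul_apply]⟩
  | succ k ih =>
    obtain ⟨z, hz⟩ := ih
    obtain ⟨z', hz'⟩ := exists_pow_lie_eq l y k
    refine ⟨antiMul l z + (2 : ℂ) ^ k • z', ?_⟩
    rw [lie_add, lie_add, lie_smul, lie_smul, lie_antiMul, lie_antiMul, ← hz, ← hz',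
      antiMul_pow_succ, map_sub, map_smul]
    have h : l * l ^ (k + 1) = l ^ (k + 1) * l := (pow_mul_comm' l _).symm
    simp only [antiMul_apply, Ring.lie_def, pow_succ l (k + 1), mul_add, add_mul, mul_sub, sub_mul,
      ← mul_assoc, h]
    simp only [mul_assoc]
    module

theorem exists_pow_lie_sub_eq (l y : A) (k : ℕ) :
    ∃ z, (2 : ℂ) ^ k • ⁅l ^ (k + 1), y⁆ - ((k : ℂ) + 1) • ⁅l, (antiMul l ^ k) y⁆ =
      ⁅l, ⁅l, ⁅l, z⁆⁆⁆ := by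
  induction k generalizing y with
  | zero => exact ⟨0, by simp⟩
  | succ k ih =>
    obtain ⟨z, hz⟩ := exists_pow_antiMul_sub_eq l y k
    obtain ⟨z', hz'⟩ := ih (antiMul l y)
    refine ⟨z + z', ?_⟩
    rw [lie_add, lie_add, lie_add, ← hz, ← hz', ← antiMul_pow_succ', lie_sub, lie_smul]
    have h : l * l ^ (k + 1) = l ^ (k + 1) * l := (pow_mul_comm' l _).symm
    have e : (2 : ℂ) • ⁅l ^ (k + 1 + 1), y⁆ =
        ⁅l, l ^ (k + 1) * y + y * l ^ (k + 1)⁆ + ⁅l ^ (k + 1), antiMul l y⁆ := by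
      simp only [antiMul_apply, Ring.lie_def, pow_succ l (k + 1), mul_add, add_mul,
        ← mul_assoc, h]
      simp only [mul_assoc, h]
      module
    rw [pow_succ, mul_smul, e]
    push_cast
    module

theorem exists_pow_lie_sub_mem (l y : A) (k : ℕ) :
    (2 : ℂ) ^ k • ⁅l ^ (k + 1), y⁆ - ((k : ℂ) + 1) • ⁅l, (antiMul l ^ k) y⁆ ∈ lcs n 4 := by
  obtain ⟨z, hz⟩ := exists_pow_lie_sub_eq l y k
  rw [hz]
  exact lie_mem_lcs_succ (by omega) _ (lie_mem_lcs_succ (by omega) _ (lie_mem_lcs_two _ _))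

theorem lie_mul_lie_mem_lcs_three (x F y : A) : ⁅x, F * ⁅x, y⁆⁆ ∈ lcs n 3 := by
  have e : 2 • ⁅x, F * ⁅x, y⁆⁆ =
      ⁅x, ⁅F, ⁅x, y⁆⁆⁆ - ⁅F, ⁅x * x, y⁆⁆ + ⁅x * F + F * x, ⁅x, y⁆⁆ := by
    simp only [Ring.lie_def]
    noncomm_ring
  have h (a b c : A) : ⁅a, ⁅b, c⁆⁆ ∈ lcs n 3 :=
    lie_mem_lcs_succ (by omega) a (lie_mem_lcs_two b c)
  rw [← nsmul_mem_iff two_ne_zero, e]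
  exact Submodule.add_mem _ (Submodule.sub_mem _ (h _ _ _) (h _ _ _)) (h _ _ _)

theorem lie_mul_lie_mem_lcs_three' (x F y : A) : ⁅x, F * ⁅y, x⁆⁆ ∈ lcs n 3 := by
  rw [← lie_skew y x, mul_neg, lie_neg]
  exact Submodule.neg_mem _ (lie_mul_lie_mem_lcs_three x F y)

theorem lie_lie_mem_lcsIdeal_three (a b c : A) : ⁅⁅a, b⁆, c⁆ ∈ lcsIdeal n 3 :=
  mem_lie_comm (lcs_le_lcsIdeal _ (lie_mem_lcs_succ (by omega) c (lie_mem_lcs_two a b)))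

theorem lie_mul_mul_lie_mem_lcsIdeal_three (a b d r : A) :
    ⁅a, b⁆ * r * ⁅a, d⁆ ∈ lcsIdeal n 3 := by
  have key : ⁅a, b⁆ * ⁅a, d⁆ ∈ lcsIdeal n 3 := by
    have e : 2 • (⁅a, b⁆ * ⁅a, d⁆) =
        ⁅⁅a * a, b⁆, d⁆ - a * ⁅⁅a, b⁆, d⁆ - ⁅⁅a, b⁆, d⁆ * a + ⁅⁅a, b⁆, ⁅a, d⁆⁆ := by
      simp only [Ring.lie_def]
      noncomm_ring
    have h := lie_lie_mem_lcsIdeal_three (n := n)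
    rw [← nsmul_mem_iff two_ne_zero, e]
    exact Submodule.add_mem _ (Submodule.sub_mem _ (Submodule.sub_mem _ (h _ _ _)
      (mul_mem_lcsIdeal_left _ (h _ _ _))) (mul_mem_lcsIdeal_right _ (h _ _ _))) (h _ _ _)
  have e : ⁅a, b⁆ * r * ⁅a, d⁆ = r * (⁅a, b⁆ * ⁅a, d⁆) + ⁅⁅a, b⁆, r⁆ * ⁅a, d⁆ := by
    rw [Ring.lie_def ⁅a, b⁆ r]
    noncomm_ring
  rw [e]
  exact Submodule.add_mem _ (mul_mem_lcsIdeal_left _ key)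
    (mul_mem_lcsIdeal_right _ (lie_lie_mem_lcsIdeal_three a b r))

theorem lcsIdeal_two_le {P : Submodule ℂ A}
    (h : ∀ (p r : A) (i j : Fin n), p * ⁅FreeAlgebra.ι ℂ i, FreeAlgebra.ι ℂ j⁆ * r ∈ P) :
    lcsIdeal n 2 ≤ P := by
  have hι (i : Fin n) (b p r : A) : p * ⁅FreeAlgebra.ι ℂ i, b⁆ * r ∈ P := by
    induction b using FreeAlgebra.induction generalizing p r with
    | grade0 c =>
      rw [Ring.lie_def, Algebra.commutes, sub_self]
      simp
    | grade1 j => exact h p r i j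
    | mul b c hb hc =>
      have e : p * ⁅FreeAlgebra.ι ℂ i, b * c⁆ * r =
          p * ⁅FreeAlgebra.ι ℂ i, b⁆ * (c * r) + p * b * ⁅FreeAlgebra.ι ℂ i, c⁆ * r := by
        simp only [Ring.lie_def]
        noncomm_ring
      rw [e]
      exact Submodule.add_mem _ (hb _ _) (hc _ _)
    | add b c hb hc =>
      rw [lie_add, mul_add, add_mul]
      exact Submodule.add_mem _ (hb _ _) (hc _ _)
  have hall (a b p r : A) : p * ⁅a, b⁆ * r ∈ P := by
    induction a using FreeAlgebra.induction generalizing p r with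
    | grade0 c =>
      rw [Ring.lie_def, Algebra.commutes, sub_self]
      simp
    | grade1 j => exact hι j b p r
    | mul a c ha hc =>
      have e : p * ⁅a * c, b⁆ * r = p * ⁅a, b⁆ * (c * r) + p * a * ⁅c, b⁆ * r := by
        simp only [Ring.lie_def]
        noncomm_ring
      rw [e]
      exact Submodule.add_mem _ (ha _ _) (hc _ _)
    | add a c ha hc =>
      rw [add_lie, mul_add, add_mul]
      exact Submodule.add_mem _ (ha _ _) (hc _ _)
  refine Submodule.span_le.2 ?_
  rintro _ ⟨p, w, r, hw, rfl⟩
  have : lcs n (1 + 1) ≤ P.comap (LinearMap.mulLeftRight ℂ (p, r)) :=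
    lcs_succ_le le_rfl fun a b _ => by simpa using hall a b p r
  simpa using this hw

theorem lie_pow_mul_mem_lcs_three {V : A} (l : A) (hV : V ∈ lcs n 2) (s : ℕ) :
    ⁅l, l ^ s * V⁆ ∈ lcs n 3 := by
  have h1 : ((s : ℂ) + 1) • ⁅l, (antiMul l ^ s) V⁆ ∈ lcs n 3 := by
    have := Submodule.sub_mem _ (Submodule.smul_mem _ ((2 : ℂ) ^ s)
      (lie_mem_lcs_succ (by omega) (l ^ (s + 1)) hV))
      (lcs_antitone (show 3 ≤ 4 by omega) (exists_pow_lie_sub_mem l V s))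
    rwa [sub_sub_cancel] at this
  rw [Submodule.smul_mem_iff _ (by exact_mod_cast s.succ_ne_zero)] at h1
  have h2 := Submodule.sub_mem _ h1
    (lie_mem_lcs_succ (by omega) l (antiMul_pow_sub_mem_lcs_two l V s))
  rwa [← lie_sub, sub_sub_cancel, lie_smul,
    Submodule.smul_mem_iff _ (pow_ne_zero s two_ne_zero)] at h2

/-- The span of the generators and of their pairwise products. -/
def quadSpan (n : ℕ) : Submodule ℂ (FreeAlgebra ℂ (Fin n)) := genSpan n ⊔ genSpan n * genSpan n

/-- The span of the brackets of `quadSpan n` with `lcs n m`, together with `lcs n (m + 2)`. -/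
def quadLie (n m : ℕ) : Submodule ℂ (FreeAlgebra ℂ (Fin n)) :=
  Submodule.span ℂ {y | ∃ q ∈ quadSpan n, ∃ w ∈ lcs n m, y = ⁅q, w⁆} ⊔ lcs n (m + 2)

theorem genSpan_le_quadSpan : genSpan n ≤ quadSpan n := le_sup_left

theorem mul_mem_quadSpan {l y : A} (hl : l ∈ genSpan n) (hy : y ∈ genSpan n) :
    l * y ∈ quadSpan n := Submodule.mem_sup_right (Submodule.mul_mem_mul hl hy)

theorem antiMul_mem_quadSpan {l y : A} (hl : l ∈ genSpan n) (hy : y ∈ genSpan n) :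
    antiMul l y ∈ quadSpan n :=
  Submodule.add_mem _ (mul_mem_quadSpan hl hy) (mul_mem_quadSpan hy hl)

theorem lie_mem_quadLie {m : ℕ} {q w : A} (hq : q ∈ quadSpan n) (hw : w ∈ lcs n m) :
    ⁅q, w⁆ ∈ quadLie n m :=
  Submodule.mem_sup_left (Submodule.subset_span ⟨q, hq, w, hw, rfl⟩)

theorem lcs_le_quadLie {m k : ℕ} (h : m + 2 ≤ k) : lcs n k ≤ quadLie n m :=
  (lcs_antitone h).trans le_sup_right

theorem lie_pow_lie_mem {S : Submodule ℂ A} {l y : A} (t : ℕ) (hS : lcs n (2 * t + 5) ≤ S)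
    (h0 : ∀ u ∈ lcsIdeal n (2 * t + 1), ⁅⁅l, y⁆, u⁆ ∈ S)
    (h1 : ∀ u ∈ lcsIdeal n (2 * t + 1), ⁅antiMul l ⁅l, y⁆, u⁆ ∈ S)
    (h2 : ∀ k, ∀ u ∈ lcsIdeal n (2 * t + 1), ⁅l, ⁅l, ⁅(antiMul l ^ k) ⁅l, y⁆, u⁆⁆⁆ ∈ S)
    (k : ℕ) {u : A} (hu : u ∈ lcsIdeal n (2 * t + 1)) : ⁅⁅l ^ (k + 1), y⁆, u⁆ ∈ S := by
  have hT {u : A} (hu : u ∈ lcsIdeal n (2 * t + 1)) : antiMul l u ∈ lcsIdeal n (2 * t + 1) :=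
    Submodule.add_mem _ (mul_mem_lcsIdeal_left _ hu) (mul_mem_lcsIdeal_right _ hu)
  have key (k : ℕ) : (∀ u ∈ lcsIdeal n (2 * t + 1), ⁅(antiMul l ^ k) ⁅l, y⁆, u⁆ ∈ S) ∧
      ∀ u ∈ lcsIdeal n (2 * t + 1), ⁅(antiMul l ^ (k + 1)) ⁅l, y⁆, u⁆ ∈ S := by
    induction k with
    | zero => exact ⟨h0, by simpa only [zero_add, pow_one] using h1⟩
    | succ k ih =>
      refine ⟨ih.2, fun u hu => ?_⟩
      have hT2 := ih.2 _ (hT hu)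
      rw [antiMul_pow_succ] at hT2
      rw [antiMul_pow_succ, antiMul_pow_succ, lie_antiMul_antiMul]
      exact Submodule.add_mem _ (Submodule.sub_mem _ (Submodule.smul_of_tower_mem _ _ hT2)
        (ih.1 _ (hT (hT hu)))) (h2 k u hu)
  have h := hS (lcs_antitone (by omega)
    (lie_mem_lcs_add_of_mem_lcsIdeal t (by omega) (exists_pow_lie_sub_mem l y k) hu))
  rw [sub_lie, smul_lie, smul_lie, lie_antiMul_pow] at h
  rwa [Submodule.sub_mem_iff_left _ (Submodule.smul_mem _ _ ((key k).1 u hu)),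
    Submodule.smul_mem_iff _ (pow_ne_zero k two_ne_zero)] at h

theorem pow_lie_mem_quadLie_even (t : ℕ) {l w : A} (hl : l ∈ genSpan n) (k : ℕ)
    (hw : w ∈ lcs n (2 * t + 2)) : ⁅l ^ k, w⁆ ∈ quadLie n (2 * t + 2) := by
  rcases k with - | k
  · simp [Ring.lie_def]
  refine lie_mem_of_mem_span ?_ (lcs_le_genLie_lcsIdeal (by omega) hw)
  rintro _ ⟨i, u, hu, rfl⟩
  have hi := ι_mem_genSpan i
  have hq {q q' u : A} (hq : q ∈ quadSpan n) (hq' : q' ∈ quadSpan n)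
      (hu : u ∈ lcsIdeal n (2 * t + 1)) : ⁅⁅q, q'⁆, u⁆ ∈ quadLie n (2 * t + 2) := by
    rw [lie_lie]
    exact Submodule.sub_mem _ (lie_mem_quadLie hq (lie_mem_lcs_of_mem_lcsIdeal t _ hu))
      (lie_mem_quadLie hq' (lie_mem_lcs_of_mem_lcsIdeal t _ hu))
  rw [leibniz_lie]
  refine Submodule.add_mem _ ?_
    (lie_mem_quadLie (genSpan_le_quadSpan hi) (lie_mem_lcs_of_mem_lcsIdeal t _ hu))
  refine lie_pow_lie_mem t (lcs_le_quadLie (by omega)) (fun u hu => ?_) (fun u hu => ?_)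
    (fun k u hu => ?_) k hu
  · exact hq (genSpan_le_quadSpan hl) (genSpan_le_quadSpan hi) hu
  · rw [← lie_antiMul]
    exact hq (genSpan_le_quadSpan hl) (antiMul_mem_quadSpan hl hi) hu
  · exact lcs_le_quadLie le_rfl (lie_mem_lcs_succ (by omega) _
      (lie_mem_lcs_succ (by omega) _ (lie_mem_lcs_of_mem_lcsIdeal t _ hu)))

theorem pow_lie_mem_quadLie_odd (t : ℕ) (hS : lcs n (2 * t + 3) ≤ quadLie n (2 * t + 2))
    {l w : A} (hl : l ∈ genSpan n) (k : ℕ) (hw : w ∈ lcs n (2 * t + 3)) :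
    ⁅l ^ k, w⁆ ∈ quadLie n (2 * t + 3) := by
  induction k using Nat.twoStepInduction generalizing w with
  | zero => simp [Ring.lie_def]
  | one => exact lie_mem_quadLie (genSpan_le_quadSpan (by simpa using hl)) hw
  | more k _ ih =>
    have hll : l * l ∈ quadSpan n := mul_mem_quadSpan hl hl
    have hl' := genSpan_le_quadSpan hl
    have hqq {q q' c : A} (hq : q ∈ quadSpan n) (hq' : q' ∈ quadSpan n)
        (hc : c ∈ lcs n (2 * t + 2)) : ⁅⁅q, q'⁆, c⁆ ∈ quadLie n (2 * t + 3) := by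
      rw [lie_lie]
      exact Submodule.sub_mem _ (lie_mem_quadLie hq (lie_mem_lcs_succ (by omega) _ hc))
        (lie_mem_quadLie hq' (lie_mem_lcs_succ (by omega) _ hc))
    have hgen (i : Fin n) {q u : A} (hq : q ∈ quadSpan n) (hu : u ∈ lcsIdeal n (2 * t + 1)) :
        ⁅l ^ (k + 2), ⁅q, ⁅FreeAlgebra.ι ℂ i, u⁆⁆⁆ ∈ quadLie n (2 * t + 3) := by
      have hi := ι_mem_genSpan i
      set x := FreeAlgebra.ι ℂ i
      have hi' := genSpan_le_quadSpan hi
      have e : ⁅l ^ (k + 2), ⁅q, ⁅x, u⁆⁆⁆ =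
          ⁅⁅l ^ (k + 2), ⁅q, x⁆⁆, u⁆ + ⁅⁅q, x⁆, ⁅l ^ (k + 2), u⁆⁆ +
            (⁅⁅l ^ (k + 2), x⁆, ⁅q, u⁆⁆ + ⁅x, ⁅l ^ (k + 2), ⁅q, u⁆⁆⁆) := by
        rw [← leibniz_lie, ← leibniz_lie, ← lie_add, ← leibniz_lie]
      have hqu : ⁅q, u⁆ ∈ lcs n (2 * t + 2) := lie_mem_lcs_of_mem_lcsIdeal t q hu
      rw [e]
      refine Submodule.add_mem _ (Submodule.add_mem _ ?_
        (hqq hq hi' (lie_mem_lcs_of_mem_lcsIdeal t _ hu))) (Submodule.add_mem _ ?_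
        (lie_mem_quadLie hi' (lie_mem_lcs_succ (by omega) _ hqu)))
      · have hω {p u : A} (hp : p ∈ quadSpan n) (hu : u ∈ lcsIdeal n (2 * t + 1)) :
            ⁅⁅p, ⁅q, x⁆⁆, u⁆ ∈ quadLie n (2 * t + 3) := by
          rw [lie_lie]
          refine Submodule.sub_mem _ (lie_mem_quadLie hp ?_)
            (hqq hq hi' (lie_mem_lcs_of_mem_lcsIdeal t _ hu))
          exact lcs_antitone (by omega)
            (lie_mem_lcs_add_of_mem_lcsIdeal t (by omega) (lie_mem_lcs_two q x) hu)
        refine lie_pow_lie_mem t (lcs_le_quadLie le_rfl) (fun u hu => hω hl' hu)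
          (fun u hu => ?_) (fun k u hu => ?_) (k + 1) hu
        · have : antiMul l ⁅l, ⁅q, x⁆⁆ = ⁅l * l, ⁅q, x⁆⁆ := by
            simp only [antiMul_apply, Ring.lie_def]
            noncomm_ring
          rw [this]
          exact hω hll hu
        · rw [← lie_antiMul_pow]
          exact lcs_le_quadLie (by omega) (lie_mem_lcs_succ (by omega) _
            (lie_mem_lcs_succ (by omega) _
              (lie_mem_lcs_add_of_mem_lcsIdeal t (by omega) (lie_mem_lcs_two _ _) hu)))
      · have hx : antiMul l x ∈ quadSpan n := antiMul_mem_quadSpan hl hi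
        have h1 : ⁅⁅l ^ (k + 1), antiMul l x⁆, ⁅q, u⁆⁆ ∈ quadLie n (2 * t + 3) := by
          rw [lie_lie]
          exact Submodule.sub_mem _ (ih (lie_mem_lcs_succ (by omega) _ hqu))
            (lie_mem_quadLie hx (lie_mem_lcs_succ (by omega) _ hqu))
        have hP := Submodule.sub_mem _
          (Submodule.smul_mem _ ((k : ℂ) + 1) (exists_pow_lie_sub_mem l x (k + 1)))
          (Submodule.smul_mem _ ((k : ℂ) + 2) (exists_pow_lie_sub_mem l (antiMul l x) k))
        have e2 : ((k : ℂ) + 1) • ((2 : ℂ) ^ (k + 1) • ⁅l ^ (k + 1 + 1), x⁆ -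
              (((k + 1 : ℕ) : ℂ) + 1) • ⁅l, (antiMul l ^ (k + 1)) x⁆) -
            ((k : ℂ) + 2) • ((2 : ℂ) ^ k • ⁅l ^ (k + 1), antiMul l x⁆ -
              ((k : ℂ) + 1) • ⁅l, (antiMul l ^ k) (antiMul l x)⁆) =
            (((k : ℂ) + 1) * 2 ^ (k + 1)) • ⁅l ^ (k + 2), x⁆ -
              (((k : ℂ) + 2) * 2 ^ k) • ⁅l ^ (k + 1), antiMul l x⁆ := by
          rw [← antiMul_pow_succ']
          push_cast
          module
        rw [e2] at hP
        have h2 := lcs_le_quadLie (m := 2 * t + 3) (by omega)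
          (lie_mem_lcs_add (by omega) (by omega) hP hqu)
        rw [sub_lie, smul_lie, smul_lie] at h2
        rwa [Submodule.sub_mem_iff_left _ (Submodule.smul_mem _ _ h1), Submodule.smul_mem_iff _
          (mul_ne_zero (by exact_mod_cast k.succ_ne_zero) (pow_ne_zero _ two_ne_zero))] at h2
    have hle : quadLie n (2 * t + 2) ≤ (quadLie n (2 * t + 3)).comap
        (LieAlgebra.ad ℂ A (l ^ (k + 2)) : A →ₗ[ℂ] A) := by
      refine sup_le (Submodule.span_le.2 ?_) fun v hv => ?_
      · rintro _ ⟨q, hq, v, hv, rfl⟩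
        have : genLie (lcsIdeal n (2 * t + 1)) ≤ (quadLie n (2 * t + 3)).comap
            ((LieAlgebra.ad ℂ A (l ^ (k + 2)) : A →ₗ[ℂ] A) ∘ₗ (LieAlgebra.ad ℂ A q)) := by
          refine Submodule.span_le.2 ?_
          rintro _ ⟨i, u, hu, rfl⟩
          exact hgen i hq hu
        exact this (lcs_le_genLie_lcsIdeal (by omega) hv)
      · exact lcs_le_quadLie le_rfl (lie_mem_lcs_succ (by omega) _ hv)
    exact hle (hS hw)

end LowerCentralSeries

section ThreeGenerators

attribute [local instance] LieRing.ofAssociativeRing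

local notation "A" => FreeAlgebra ℂ (Fin 3)

local notation "x" => FreeAlgebra.ι ℂ (X := Fin 3)

theorem mul_lie_mem_lcsIdeal_three {u : A} (hu : u ∈ lcsIdeal 3 2) (j k : Fin 3) :
    u * ⁅x j, x k⁆ ∈ lcsIdeal 3 3 := by
  have : lcsIdeal 3 2 ≤ (lcsIdeal 3 3).comap (LinearMap.mulRight ℂ ⁅x j, x k⁆) := by
    refine lcsIdeal_two_le fun p r a b => ?_
    rw [Submodule.mem_comap, LinearMap.mulRight_apply, mul_assoc, mul_assoc, ← mul_assoc ⁅_, _⁆]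
    refine mul_mem_lcsIdeal_left _ ?_
    have h := lie_mul_mul_lie_mem_lcsIdeal_three (n := 3)
    have hc : a = j ∨ a = k ∨ b = j ∨ b = k ∨ j = k ∨ a = b := by decide +revert
    rcases hc with rfl | rfl | rfl | rfl | rfl | rfl
    · exact h _ _ _ _
    · rw [← lie_skew (x j), mul_neg]
      exact Submodule.neg_mem _ (h _ _ _ _)
    · rw [← lie_skew, neg_mul, neg_mul]
      exact Submodule.neg_mem _ (h _ _ _ _)
    · rw [← lie_skew, neg_mul, neg_mul, ← lie_skew (x j), mul_neg]
      exact Submodule.neg_mem _ (Submodule.neg_mem _ (h _ _ _ _))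
    · simp
    · simp
  exact this hu

theorem lie_pow_mul_lie_mem_lcs_three {l : A} (hl : l ∈ genSpan 3) (s : ℕ) (i j k : Fin 3) :
    ⁅x i, l ^ s * ⁅x j, x k⁆⁆ ∈ lcs 3 3 := by
  have hfirst (i j : Fin 3) := lie_mul_lie_mem_lcs_three (x i) (l ^ s) (x j)
  have hlast (i j : Fin 3) := lie_mul_lie_mem_lcs_three' (x i) (l ^ s) (x j)
  by_cases hij : i = j
  · subst hij; exact hfirst _ _
  by_cases hik : i = k
  · subst hik; exact hlast _ _
  by_cases hjk : j = k
  · subst hjk; simp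
  obtain ⟨c, rfl⟩ := (Submodule.mem_span_range_iff_exists_fun ℂ).1 hl
  set l := ∑ i, c i • x i with hl'
  have key {i j k : Fin 3} (hij : i ≠ j) (hik : i ≠ k) (hjk : j ≠ k) (hc : c i ≠ 0) :
      ⁅x i, l ^ s * ⁅x j, x k⁆⁆ ∈ lcs 3 3 := by
    have h := lie_pow_mul_mem_lcs_three l (lie_mem_lcs_two (x j) (x k)) s
    nth_rw 1 [hl'] at h
    rw [sum_lie, ← Finset.add_sum_erase _ _ (Finset.mem_univ i), Submodule.add_mem_iff_left,
      smul_lie, Submodule.smul_mem_iff _ hc] at h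
    · exact h
    · refine Submodule.sum_mem _ fun a ha => ?_
      rw [smul_lie]
      refine Submodule.smul_mem _ _ ?_
      have hai := Finset.ne_of_mem_erase ha
      have : a = j ∨ a = k := by
        clear * - hij hik hjk hai
        decide +revert
      rcases this with rfl | rfl
      · exact hfirst _ _
      · exact hlast _ _
  by_cases hc : ∃ a, c a ≠ 0
  · obtain ⟨a, ha⟩ := hc
    have : a = i ∨ a = j ∨ a = k := by
      clear * - hij hik hjk
      decide +revert
    have hsum (y z w F : A) : ⁅y, F * ⁅z, w⁆⁆ =
        ⁅y + z, F * ⁅y + z, w⁆⁆ - ⁅y, F * ⁅y, w⁆⁆ - ⁅z, F * ⁅z, w⁆⁆ - ⁅z, F * ⁅y, w⁆⁆ := by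
      simp only [Ring.lie_def]
      noncomm_ring
    have hswap {y z w : A} (h : ⁅z, l ^ s * ⁅y, w⁆⁆ ∈ lcs 3 3) :
        ⁅y, l ^ s * ⁅z, w⁆⁆ ∈ lcs 3 3 := by
      rw [hsum]
      have h' := lie_mul_lie_mem_lcs_three (n := 3)
      exact Submodule.sub_mem _ (Submodule.sub_mem _ (Submodule.sub_mem _ (h' _ _ _) (h' _ _ _))
        (h' _ _ _)) h
    rcases this with rfl | rfl | rfl
    · exact key hij hik hjk ha
    · exact hswap (key (Ne.symm hij) hjk hik ha)
    · rw [← lie_skew (x j), mul_neg, lie_neg]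
      refine Submodule.neg_mem _ (hswap ?_)
      exact key (Ne.symm hik) (Ne.symm hjk) hij ha
  · push Not at hc
    have hl0 : l = 0 := by simp [hl', hc]
    rw [hl0]
    rcases s with - | s
    · simpa using lie_mem_lcs_succ (by omega) (x i) (lie_mem_lcs_two (x j) (x k))
    · simp

theorem lie_mem_lcs_three_of_mem_lcsIdeal_two (a : A) {g : A} (hg : g ∈ lcsIdeal 3 2) :
    ⁅a, g⁆ ∈ lcs 3 3 := by
  have hM3 (a : A) {g : A} (hg : g ∈ lcsIdeal 3 3) : ⁅a, g⁆ ∈ lcs 3 3 :=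
    lcs_succ_le_self 3 (lie_mem_lcs_of_mem_lcsIdeal 1 a hg)
  have hgen (i : Fin 3) : lcsIdeal 3 2 ≤
      (lcs 3 3).comap (LieAlgebra.ad ℂ A (x i) : A →ₗ[ℂ] A) := by
    refine lcsIdeal_two_le fun p r j k => ?_
    rw [Submodule.mem_comap, LieAlgebra.ad_apply]
    have e : p * ⁅x j, x k⁆ * r = p * r * ⁅x j, x k⁆ + p * ⁅⁅x j, x k⁆, r⁆ := by
      rw [Ring.lie_def ⁅x j, x k⁆ r]
      noncomm_ring
    rw [e, lie_add]
    refine Submodule.add_mem _ ?_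
      (hM3 _ (mul_mem_lcsIdeal_left _ (lie_lie_mem_lcsIdeal_three _ _ _)))
    have : powSpan 3 ≤ (lcs 3 3).comap
        ((LieAlgebra.ad ℂ A (x i) : A →ₗ[ℂ] A) ∘ₗ LinearMap.mulRight ℂ ⁅x j, x k⁆) := by
      refine sup_le (Submodule.span_le.2 ?_) fun u hu => ?_
      · rintro _ ⟨l, hl, s, rfl⟩
        exact lie_pow_mul_lie_mem_lcs_three hl s i j k
      · exact hM3 _ (mul_lie_mem_lcsIdeal_three hu j k)
    exact this (mem_powSpan (p * r))
  have h := lie_mem_genLie (M := lcsIdeal 3 2) (fun a _ => mul_mem_lcsIdeal_left a)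
    (fun a _ => mul_mem_lcsIdeal_right a) a hg
  refine (Submodule.span_le.2 ?_ : genLie (lcsIdeal 3 2) ≤ lcs 3 3) h
  rintro _ ⟨i, u, hu, rfl⟩
  exact hgen i hu

theorem lie_mem_lcs_add_two_of_mem_lcsIdeal_two {m : ℕ} (hm : 1 ≤ m) {g w : A}
    (hg : g ∈ lcsIdeal 3 2) (hw : w ∈ lcs 3 m) : ⁅g, w⁆ ∈ lcs 3 (m + 2) := by
  induction m, hm using Nat.le_induction generalizing w with
  | base => exact mem_lie_comm (lie_mem_lcs_three_of_mem_lcsIdeal_two w hg)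
  | succ m hm ih =>
    have : lcs 3 (m + 1) ≤ (lcs 3 (m + 1 + 2)).comap (LieAlgebra.ad ℂ A g : A →ₗ[ℂ] A) := by
      refine lcs_succ_le hm fun a v hv => ?_
      rw [Submodule.mem_comap, LieAlgebra.ad_apply, leibniz_lie g a v]
      refine Submodule.add_mem _ ?_ (lie_mem_lcs_succ (by omega) a (ih hv))
      rw [show m + 1 + 2 = 3 + m by omega]
      exact lie_mem_lcs_add (by omega) hm
        (mem_lie_comm (lie_mem_lcs_three_of_mem_lcsIdeal_two a hg)) hv
    exact this hw

end ThreeGenerators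

section QuadraticSpan

attribute [local instance] LieRing.ofAssociativeRing

theorem lcs_succ_le_quadLie {m : ℕ} (hm : 1 ≤ m)
    (h : ∀ l ∈ genSpan 3, ∀ k : ℕ, ∀ w ∈ lcs 3 m, ⁅l ^ k, w⁆ ∈ quadLie 3 m) :
    lcs 3 (m + 1) ≤ quadLie 3 m := by
  refine lcs_succ_le hm fun a w hw => ?_
  obtain ⟨p, hp, g, hg, rfl⟩ := Submodule.mem_sup.1 (mem_powSpan a)
  rw [add_lie]
  refine Submodule.add_mem _ (lie_mem_of_mem_span_left ?_ hp)
    (lcs_le_quadLie le_rfl (lie_mem_lcs_add_two_of_mem_lcsIdeal_two hm hg hw))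
  rintro _ ⟨l, hl, k, rfl⟩
  exact h l hl k w hw

theorem lcs_succ_le_quadLie_of_two_le {m : ℕ} (hm : 2 ≤ m) : lcs 3 (m + 1) ≤ quadLie 3 m := by
  have heven (t : ℕ) : lcs 3 (2 * t + 2 + 1) ≤ quadLie 3 (2 * t + 2) :=
    lcs_succ_le_quadLie (by omega) fun _ hl k _ hw => pow_lie_mem_quadLie_even t hl k hw
  obtain ⟨t, rfl | rfl⟩ : ∃ t, m = 2 * t + 2 ∨ m = 2 * t + 3 := ⟨(m - 2) / 2, by omega⟩
  · exact heven t
  · exact lcs_succ_le_quadLie (by omega) fun _ hl k _ hw =>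
      pow_lie_mem_quadLie_odd t (heven t) hl k hw

theorem le_sum_submodule {R M ι : Type*} [Semiring R] [AddCommMonoid M] [Module R M]
    {s : Finset ι} (f : ι → Submodule R M) {i : ι} (hi : i ∈ s) : f i ≤ ∑ j ∈ s, f j := by
  classical
  rw [← Finset.add_sum_erase _ _ hi]
  exact le_sup_left

theorem sum_submodule_le {R M ι : Type*} [Semiring R] [AddCommMonoid M] [Module R M]
    {s : Finset ι} {f : ι → Submodule R M} {P : Submodule R M} (h : ∀ i ∈ s, f i ≤ P) :
    ∑ j ∈ s, f j ≤ P :=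
  Finset.sum_induction f (· ≤ P) (fun _ _ => sup_le) bot_le h

theorem brS_le_lcs_succ {n m : ℕ} (hm : 1 ≤ m) (g : FreeAlgebra ℂ (Fin n)) :
    brS g (lcs n m) ≤ lcs n (m + 1) := by
  refine Submodule.span_le.2 ?_
  rintro _ ⟨w, hw, rfl⟩
  exact lie_mem_lcs_succ hm g hw

theorem quadLie_le (m : ℕ) (hm : 1 ≤ m) :
    quadLie 3 m ≤
      (∑ i : Fin 3, brS (FreeAlgebra.ι ℂ i) (lcs 3 m))
      + (∑ p ∈ Finset.univ.filter (fun p : Fin 3 × Fin 3 => p.1 ≤ p.2),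
          brS (FreeAlgebra.ι ℂ p.1 * FreeAlgebra.ι ℂ p.2) (lcs 3 m))
      + lcs 3 (m + 2) := by
  set x : Fin 3 → FreeAlgebra ℂ (Fin 3) := FreeAlgebra.ι ℂ with hx
  set P := (∑ i, brS (x i) (lcs 3 m))
    + (∑ p ∈ Finset.univ.filter (fun p : Fin 3 × Fin 3 => p.1 ≤ p.2),
        brS (x p.1 * x p.2) (lcs 3 m)) + lcs 3 (m + 2)
  have hP : lcs 3 (m + 2) ≤ P := le_sup_right
  have hlin (i : Fin 3) {w : FreeAlgebra ℂ (Fin 3)} (hw : w ∈ lcs 3 m) : ⁅x i, w⁆ ∈ P :=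
    Submodule.mem_sup_left (Submodule.mem_sup_left (le_sum_submodule
      (fun i => brS (x i) (lcs 3 m)) (Finset.mem_univ i) (Submodule.subset_span ⟨w, hw, rfl⟩)))
  have hquad {i j : Fin 3} (hij : i ≤ j) {w : FreeAlgebra ℂ (Fin 3)} (hw : w ∈ lcs 3 m) :
      ⁅x i * x j, w⁆ ∈ P :=
    Submodule.mem_sup_left (Submodule.mem_sup_right (le_sum_submodule
      (fun p : Fin 3 × Fin 3 => brS (x p.1 * x p.2) (lcs 3 m))
      (Finset.mem_filter.2 ⟨Finset.mem_univ (i, j), hij⟩) (Submodule.subset_span ⟨w, hw, rfl⟩)))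
  refine sup_le (Submodule.span_le.2 ?_) hP
  rintro _ ⟨q, hq, w, hw, rfl⟩
  obtain ⟨a, ha, b, hb, rfl⟩ := Submodule.mem_sup.1 hq
  rw [genSpan, Submodule.span_mul_span] at hb
  rw [add_lie]
  refine Submodule.add_mem _ (lie_mem_of_mem_span_left ?_ ha) (lie_mem_of_mem_span_left ?_ hb)
  · rintro _ ⟨i, rfl⟩
    exact hlin i hw
  · rintro _ ⟨_, ⟨i, rfl⟩, _, ⟨j, rfl⟩, rfl⟩
    rcases le_total i j with hij | hij
    · exact hquad hij hw
    · have e : x i * x j = x j * x i + ⁅x i, x j⁆ := by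
        rw [Ring.lie_def]
        abel
      change ⁅x i * x j, w⁆ ∈ P
      rw [e, add_lie]
      refine Submodule.add_mem _ (hquad hij hw) (hP ?_)
      rw [add_comm]
      exact lie_mem_lcs_add (by omega) (by omega) (lie_mem_lcs_two _ _) hw

end QuadraticSpan

/-- for `n = 3` and `m ≥ 2`,
`L_{m+1} = Σ_i [x_i, L_m] + Σ_{i ≤ j} [x_i x_j, L_m] + L_{m+2}`. -/
theorem stmt_2 (m : ℕ) (hm : 2 ≤ m) :
    lcs 3 (m + 1) =
      (∑ i : Fin 3, brS (FreeAlgebra.ι ℂ i) (lcs 3 m))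
      + (∑ p ∈ Finset.univ.filter (fun p : Fin 3 × Fin 3 => p.1 ≤ p.2),
          brS (FreeAlgebra.ι ℂ p.1 * FreeAlgebra.ι ℂ p.2) (lcs 3 m))
      + lcs 3 (m + 2) := by
  refine le_antisymm ((lcs_succ_le_quadLie_of_two_le hm).trans (quadLie_le m (by omega))) ?_
  exact sup_le (sup_le (sum_submodule_le fun i _ => brS_le_lcs_succ (by omega) _)
      (sum_submodule_le fun p _ => brS_le_lcs_succ (by omega) _)) (lcs_succ_le_self _)
end

section
/- Let n = 2k with k ≥ 1, and let v = [x_1, [x_1,x_2]·[x_3,x_4]·…·[x_{2k−1},x_{2k}]] ∈ A, the bracket of x_1 with the product of the commutators [x_{2j−1}, x_{2j}] for j = 1, …, k. Then v lies in L_3 but does not lie in L_4; in particular its image in B_3 = L_3/L_4 is nonzero. -/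
section Membership

variable {n : ℕ}

theorem commutator_mem_lcs {m : ℕ} (a : FreeAlgebra ℂ (Fin n)) {w : FreeAlgebra ℂ (Fin n)}
    (hw : w ∈ lcs n (m + 1)) : a * w - w * a ∈ lcs n (m + 2) := by
  rw [lcs]
  exact Submodule.subset_span ⟨a, w, hw, rfl⟩

theorem commutator_mem_lcs_two (a b : FreeAlgebra ℂ (Fin n)) : a * b - b * a ∈ lcs n 2 :=
  commutator_mem_lcs (m := 0) a (by simp [lcs])

theorem lcs_succ_le_s12 (m : ℕ) : lcs n (m + 1) ≤ lcs n m := by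
  induction m with
  | zero => simp [lcs]
  | succ m ih =>
    cases m with
    | zero => simp [lcs]
    | succ m =>
      rw [lcs, Submodule.span_le]
      rintro _ ⟨a, w, hw, rfl⟩
      exact commutator_mem_lcs a (ih hw)

theorem commutator_mem_lcs_three_of_mul {u w : FreeAlgebra ℂ (Fin n)} (b : FreeAlgebra ℂ (Fin n))
    (hu : u ∈ lcs n 2) (hw : w ∈ lcs n 2) : b * (u * w) - u * w * b ∈ lcs n 3 := by
  have h := add_mem (commutator_mem_lcs (w * b) hu) (commutator_mem_lcs (b * u) hw)
  convert h using 1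
  noncomm_ring

/-- The two-sided ideal generated by the third term of the lower central series. -/
def lcsIdealThree (n : ℕ) : Submodule ℂ (FreeAlgebra ℂ (Fin n)) := ⊤ * lcs n 3

theorem mul_mem_lcsIdealThree (a : FreeAlgebra ℂ (Fin n)) {u : FreeAlgebra ℂ (Fin n)}
    (hu : u ∈ lcsIdealThree n) : a * u ∈ lcsIdealThree n := by
  induction hu using Submodule.mul_induction_on' with
  | mem_mul_mem c _ l hl =>
    rw [← mul_assoc]
    exact Submodule.mul_mem_mul trivial hl
  | add x _ y _ hx hy => rw [mul_add]; exact add_mem hx hy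

theorem lcs_three_le_lcsIdealThree : lcs n 3 ≤ lcsIdealThree n := fun l hl => by
  rw [← one_mul l]
  exact Submodule.mul_mem_mul trivial hl

theorem lcsIdealThree_mul_mem (a : FreeAlgebra ℂ (Fin n)) {u : FreeAlgebra ℂ (Fin n)}
    (hu : u ∈ lcsIdealThree n) : u * a ∈ lcsIdealThree n := by
  induction hu using Submodule.mul_induction_on' with
  | mem_mul_mem c _ l hl =>
    have h₁ : c * a * l ∈ lcsIdealThree n := Submodule.mul_mem_mul trivial hl
    have h₂ : c * (a * l - l * a) ∈ lcsIdealThree n :=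
      Submodule.mul_mem_mul trivial (commutator_mem_lcs a (lcs_succ_le_s12 2 hl))
    convert sub_mem h₁ h₂ using 1
    noncomm_ring
  | add x _ y _ hx hy => rw [add_mul]; exact add_mem hx hy

theorem commutator_mem_lcs_three_of_mem_lcsIdealThree (b : FreeAlgebra ℂ (Fin n))
    {u : FreeAlgebra ℂ (Fin n)} (hu : u ∈ lcsIdealThree n) : b * u - u * b ∈ lcs n 3 := by
  induction hu using Submodule.mul_induction_on' with
  | mem_mul_mem a _ l hl =>
    rw [lcs] at hl
    induction hl using Submodule.span_induction with
    | mem l hl =>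
      obtain ⟨c, w, hw, rfl⟩ := hl
      have h₁ := commutator_mem_lcs b (commutator_mem_lcs_two c (a * w))
      have h₂ := commutator_mem_lcs_three_of_mul b (commutator_mem_lcs_two c a) hw
      convert sub_mem h₁ h₂ using 1
      noncomm_ring
    | zero => simp
    | add x y _ _ hx hy => convert add_mem hx hy using 1; noncomm_ring
    | smul r x _ hx => convert Submodule.smul_mem _ r hx using 1; simp [smul_sub]
  | add x _ y _ hx hy => convert add_mem hx hy using 1; noncomm_ring

theorem commutator_list_prod_mem_lcsIdealThree (x : FreeAlgebra ℂ (Fin n))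
    (l : List (FreeAlgebra ℂ (Fin n))) (hl : ∀ u ∈ l, u ∈ lcs n 2) :
    x * l.prod - l.prod * x ∈ lcsIdealThree n := by
  induction l with
  | nil => simp
  | cons u l ih =>
    have h₁ := lcsIdealThree_mul_mem l.prod
      (lcs_three_le_lcsIdealThree (commutator_mem_lcs x (hl u (by simp))))
    have h₂ := mul_mem_lcsIdealThree u (ih fun u hu => hl u (by simp [hu]))
    convert add_mem h₁ h₂ using 1
    rw [List.prod_cons]
    noncomm_ring

theorem commutator_mul_list_prod_mem_lcs_three (x a b : FreeAlgebra ℂ (Fin n))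
    (l : List (FreeAlgebra ℂ (Fin n))) (hl : ∀ u ∈ l, u ∈ lcs n 2) :
    x * ((a * b - b * a) * l.prod) - (a * b - b * a) * l.prod * x ∈ lcs n 3 := by
  have h₁ := commutator_mem_lcs x (commutator_mem_lcs_two a (b * l.prod))
  have h₂ := commutator_mem_lcs_three_of_mem_lcsIdealThree x
    (mul_mem_lcsIdealThree b (commutator_list_prod_mem_lcsIdealThree a l hl))
  convert sub_mem h₁ h₂ using 1
  noncomm_ring

end Membership

section Exterior

open CliffordAlgebra (involute)

variable {M : Type*} [AddCommGroup M] [Module ℂ M]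

theorem ι_mul_eq_involute_mul_ι (m : M) (x : ExteriorAlgebra ℂ M) :
    ExteriorAlgebra.ι ℂ m * x = involute x * ExteriorAlgebra.ι ℂ m := by
  induction x using ExteriorAlgebra.induction with
  | algebraMap r =>
    rw [AlgHom.commutes, Algebra.commutes]
  | ι y =>
    rw [eq_neg_of_add_eq_zero_left (ExteriorAlgebra.ι_add_mul_swap m y)]
    exact (neg_mul _ _).symm.trans (congrArg (· * _) (CliffordAlgebra.involute_ι y).symm)
  | mul a b ha hb => rw [map_mul, ← mul_assoc, ha, mul_assoc, hb, mul_assoc]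
  | add a b ha hb => rw [map_add, mul_add, add_mul, ha, hb]

theorem mul_comm_of_involute_eq {x : ExteriorAlgebra ℂ M} (hx : involute x = x)
    (y : ExteriorAlgebra ℂ M) : x * y = y * x := by
  induction y using ExteriorAlgebra.induction with
  | algebraMap r => exact (Algebra.commutes r x).symm
  | ι y => rw [ι_mul_eq_involute_mul_ι, hx]
  | mul a b ha hb => rw [← mul_assoc, ha, mul_assoc, hb, mul_assoc]
  | add a b ha hb => rw [mul_add, add_mul, ha, hb]

theorem mul_eq_involute_mul_of_involute_eq_neg {x : ExteriorAlgebra ℂ M} (hx : involute x = -x)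
    (y : ExteriorAlgebra ℂ M) : x * y = involute y * x := by
  induction y using ExteriorAlgebra.induction with
  | algebraMap r => rw [AlgHom.commutes, Algebra.commutes]
  | ι y =>
    have h : x * ExteriorAlgebra.ι ℂ y = -ExteriorAlgebra.ι ℂ y * x := by
      rw [neg_mul, ι_mul_eq_involute_mul_ι, hx, neg_mul, neg_neg]
    exact h.trans (congrArg (· * _) (CliffordAlgebra.involute_ι y).symm)
  | mul a b ha hb => rw [map_mul, ← mul_assoc, ha, mul_assoc, hb, mul_assoc]
  | add a b ha hb => rw [map_add, mul_add, add_mul, ha, hb]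

theorem exists_even_add_odd (x : ExteriorAlgebra ℂ M) :
    ∃ y z : ExteriorAlgebra ℂ M, involute y = y ∧ involute z = -z ∧ x = y + z := by
  refine ⟨(2⁻¹ : ℂ) • (x + involute x), (2⁻¹ : ℂ) • (x - involute x), ?_, ?_, ?_⟩
  · rw [map_smul, map_add, CliffordAlgebra.involute_involute, add_comm]
  · rw [map_smul, map_sub, CliffordAlgebra.involute_involute, ← smul_neg, neg_sub]
  · module

theorem involute_commutator (x y : ExteriorAlgebra ℂ M) :
    involute (x * y - y * x) = x * y - y * x := by
  obtain ⟨x₀, x₁, hx₀, hx₁, rfl⟩ := exists_even_add_odd x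
  obtain ⟨y₀, y₁, hy₀, hy₁, rfl⟩ := exists_even_add_odd y
  have h₁ := mul_comm_of_involute_eq hx₀
  have h₂ := mul_comm_of_involute_eq hy₀ x₁
  simp only [map_sub, map_add, map_mul, hx₀, hx₁, hy₀, hy₁, mul_add, add_mul, h₁, h₂]
  noncomm_ring

/-- The commutator twisted by the grade involution. -/
def twistedCommutator (x u : ExteriorAlgebra ℂ M) : ExteriorAlgebra ℂ M :=
  involute x * u - u * x

theorem involute_twistedCommutator (x u : ExteriorAlgebra ℂ M) :
    involute (twistedCommutator x u) = -twistedCommutator x u := by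
  obtain ⟨x₀, x₁, hx₀, hx₁, rfl⟩ := exists_even_add_odd x
  obtain ⟨y₀, y₁, hy₀, hy₁, rfl⟩ := exists_even_add_odd u
  have h₁ := mul_comm_of_involute_eq hx₀
  have h₂ := mul_comm_of_involute_eq hy₀ x₁
  have h₃ := mul_eq_involute_mul_of_involute_eq_neg hx₁ y₁
  rw [hy₁] at h₃
  simp only [twistedCommutator, map_sub, map_add, map_mul, map_neg, hx₀, hx₁, hy₀, hy₁, mul_add,
    add_mul, h₁, h₂, h₃, neg_mul, mul_neg]
  noncomm_ring

theorem twistedCommutator_eq_zero_of_even {x : ExteriorAlgebra ℂ M} (hx : involute x = x)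
    (u : ExteriorAlgebra ℂ M) : twistedCommutator x u = 0 := by
  rw [twistedCommutator, hx, mul_comm_of_involute_eq hx, sub_self]

theorem twistedCommutator_eq_zero_of_odd {u : ExteriorAlgebra ℂ M} (hu : involute u = -u)
    (x : ExteriorAlgebra ℂ M) : twistedCommutator x u = 0 := by
  rw [twistedCommutator, mul_eq_involute_mul_of_involute_eq_neg hu, sub_self]

theorem ιMulti_pi_basis_ne_zero (n : ℕ) :
    ExteriorAlgebra.ιMulti ℂ n (fun i : Fin n => Pi.single i (1 : ℂ)) ≠ 0 := by
  intro h
  let f : ∀ i, (Fin n → ℂ) [⋀^Fin i]→ₗ[ℂ] ℂ :=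
    Function.update 0 n (Matrix.detRowAlternating (R := ℂ) (n := Fin n))
  have h₂ := ExteriorAlgebra.liftAlternating_apply_ιMulti f
    (fun i : Fin n => (Pi.single i (1 : ℂ) : Fin n → ℂ))
  rw [h, map_zero] at h₂
  simp only [f, Function.update_self] at h₂
  have h₃ : Matrix.of (fun i : Fin n => (Pi.single i (1 : ℂ) : Fin n → ℂ)) = 1 := by
    ext i j
    simp [Matrix.one_apply, Pi.single_apply, eq_comm]
  have h₄ := Matrix.det_one (n := Fin n) (R := ℂ)
  rw [← h₃] at h₄
  exact one_ne_zero (h₄.symm.trans h₂.symm)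

end Exterior

section Representation

open CliffordAlgebra (involute)

variable {M : Type*} [AddCommGroup M] [Module ℂ M] {n : ℕ}

/-- An upper triangular representation of the free algebra over an exterior algebra. -/
noncomputable def exteriorRep (e : Fin n → M) (d : Fin n → ℂ) :
    FreeAlgebra ℂ (Fin n) →ₐ[ℂ] Matrix (Fin 3) (Fin 3) (ExteriorAlgebra ℂ M) :=
  FreeAlgebra.lift ℂ fun i =>
    !![-ExteriorAlgebra.ι ℂ (e i), -ExteriorAlgebra.ι ℂ (e i), 0;
       0, -ExteriorAlgebra.ι ℂ (e i), algebraMap ℂ _ (d i);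
       0, 0, ExteriorAlgebra.ι ℂ (e i)]

variable (e : Fin n → M) (d : Fin n → ℂ)

theorem exteriorRep_triangular (a : FreeAlgebra ℂ (Fin n)) :
    exteriorRep e d a 1 0 = 0 ∧ exteriorRep e d a 2 0 = 0 ∧ exteriorRep e d a 2 1 = 0 ∧
      exteriorRep e d a 0 0 = involute (exteriorRep e d a 2 2) ∧
      exteriorRep e d a 1 1 = involute (exteriorRep e d a 2 2) := by
  induction a using FreeAlgebra.induction with
  | grade0 r =>
    simp [Matrix.algebraMap_matrix_apply]
  | grade1 i =>
    have h : -ExteriorAlgebra.ι ℂ (e i) = involute (ExteriorAlgebra.ι ℂ (e i)) :=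
      (CliffordAlgebra.involute_ι _).symm
    refine ⟨?_, ?_, ?_, ?_, ?_⟩ <;> simp only [exteriorRep, FreeAlgebra.lift_ι_apply] <;>
      first | rfl | exact h
  | mul a b ha hb =>
    obtain ⟨h₁, h₂, h₃, h₄, h₅⟩ := ha
    obtain ⟨k₁, k₂, k₃, k₄, k₅⟩ := hb
    simp [Matrix.mul_apply, Fin.sum_univ_three, h₁, h₂, h₃, h₄, h₅, k₁, k₂, k₃, k₄, k₅]
  | add a b ha hb =>
    obtain ⟨h₁, h₂, h₃, h₄, h₅⟩ := ha
    obtain ⟨k₁, k₂, k₃, k₄, k₅⟩ := hb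
    simp [h₁, h₂, h₃, h₄, h₅, k₁, k₂, k₃, k₄, k₅]

theorem exteriorRep_commutator (a b : FreeAlgebra ℂ (Fin n)) :
    exteriorRep e d (a * b - b * a) 2 2 =
        exteriorRep e d a 2 2 * exteriorRep e d b 2 2 -
          exteriorRep e d b 2 2 * exteriorRep e d a 2 2 ∧
      exteriorRep e d (a * b - b * a) 0 1 =
        (involute (exteriorRep e d a 2 2) * exteriorRep e d b 0 1 -
          exteriorRep e d b 0 1 * involute (exteriorRep e d a 2 2)) -
        (involute (exteriorRep e d b 2 2) * exteriorRep e d a 0 1 -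
          exteriorRep e d a 0 1 * involute (exteriorRep e d b 2 2)) ∧
      exteriorRep e d (a * b - b * a) 1 2 =
        twistedCommutator (exteriorRep e d a 2 2) (exteriorRep e d b 1 2) -
          twistedCommutator (exteriorRep e d b 2 2) (exteriorRep e d a 1 2) ∧
      exteriorRep e d (a * b - b * a) 0 2 =
        twistedCommutator (exteriorRep e d a 2 2) (exteriorRep e d b 0 2) -
          twistedCommutator (exteriorRep e d b 2 2) (exteriorRep e d a 0 2) +
        (exteriorRep e d a 0 1 * exteriorRep e d b 1 2 -
          exteriorRep e d b 0 1 * exteriorRep e d a 1 2) := by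
  obtain ⟨h₁, h₂, h₃, h₄, h₅⟩ := exteriorRep_triangular e d a
  obtain ⟨k₁, k₂, k₃, k₄, k₅⟩ := exteriorRep_triangular e d b
  simp only [map_sub, map_mul, Matrix.sub_apply, Matrix.mul_apply, Fin.sum_univ_three, h₁, h₂, h₃,
    h₄, h₅, k₁, k₂, k₃, k₄, k₅, twistedCommutator]
  refine ⟨?_, ?_, ?_, ?_⟩ <;> noncomm_ring

theorem exteriorRep_of_mem_lcs_two {w : FreeAlgebra ℂ (Fin n)} (hw : w ∈ lcs n 2) :
    involute (exteriorRep e d w 2 2) = exteriorRep e d w 2 2 ∧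
      involute (exteriorRep e d w 0 1) = exteriorRep e d w 0 1 ∧
      involute (exteriorRep e d w 1 2) = -exteriorRep e d w 1 2 := by
  rw [lcs] at hw
  induction hw using Submodule.span_induction with
  | mem w hw =>
    obtain ⟨a, b, -, rfl⟩ := hw
    obtain ⟨h₁, h₂, h₃, -⟩ := exteriorRep_commutator e d a b
    rw [h₁, h₂, h₃]
    refine ⟨involute_commutator _ _, ?_, ?_⟩
    · rw [map_sub, involute_commutator, involute_commutator]
    · rw [map_sub, involute_twistedCommutator, involute_twistedCommutator]
      abel
  | zero => simp
  | add x y _ _ hx hy => simp [hx, hy, add_comm]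
  | smul r x _ hx => simp [hx]

theorem exteriorRep_of_mem_lcs_three {w : FreeAlgebra ℂ (Fin n)} (hw : w ∈ lcs n 3) :
    exteriorRep e d w 2 2 = 0 ∧ exteriorRep e d w 0 1 = 0 ∧ exteriorRep e d w 1 2 = 0 := by
  rw [lcs] at hw
  induction hw using Submodule.span_induction with
  | mem w hw =>
    obtain ⟨a, b, hb, rfl⟩ := hw
    obtain ⟨h₁, h₂, h₃, -⟩ := exteriorRep_commutator e d a b
    obtain ⟨k₁, k₂, k₃⟩ := exteriorRep_of_mem_lcs_two e d hb
    rw [h₁, h₂, h₃]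
    refine ⟨?_, ?_, ?_⟩
    · rw [mul_comm_of_involute_eq k₁, sub_self]
    · rw [k₁, mul_comm_of_involute_eq k₁, mul_comm_of_involute_eq k₂, sub_self, sub_self, sub_self]
    · rw [twistedCommutator_eq_zero_of_odd k₃, twistedCommutator_eq_zero_of_even k₁, sub_self]
  | zero => simp
  | add x y _ _ hx hy => simp [hx, hy]
  | smul r x _ hx => simp [hx]

theorem exteriorRep_of_mem_lcs_four {w : FreeAlgebra ℂ (Fin n)} (hw : w ∈ lcs n 4) :
    involute (exteriorRep e d w 0 2) = -exteriorRep e d w 0 2 := by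
  rw [lcs] at hw
  induction hw using Submodule.span_induction with
  | mem w hw =>
    obtain ⟨a, b, hb, rfl⟩ := hw
    obtain ⟨-, -, -, h⟩ := exteriorRep_commutator e d a b
    obtain ⟨k₁, k₂, k₃⟩ := exteriorRep_of_mem_lcs_three e d hb
    rw [h, k₁, k₂, k₃, twistedCommutator_eq_zero_of_even (map_zero _), mul_zero, zero_mul, sub_zero,
      sub_zero, add_zero, involute_twistedCommutator]
  | zero => simp
  | add x y _ _ hx hy => simp [hx, hy, add_comm]
  | smul r x _ hx => simp [hx]

theorem exteriorRep_commutator_ι {i j : Fin n} (hi : d i = 0) (hj : d j = 0) :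
    exteriorRep e d (FreeAlgebra.ι ℂ i * FreeAlgebra.ι ℂ j - FreeAlgebra.ι ℂ j * FreeAlgebra.ι ℂ i) =
      (2 : ℂ) • !![ExteriorAlgebra.ι ℂ (e i) * ExteriorAlgebra.ι ℂ (e j),
        (2 : ℂ) • (ExteriorAlgebra.ι ℂ (e i) * ExteriorAlgebra.ι ℂ (e j)), 0;
        0, ExteriorAlgebra.ι ℂ (e i) * ExteriorAlgebra.ι ℂ (e j), 0;
        0, 0, ExteriorAlgebra.ι ℂ (e i) * ExteriorAlgebra.ι ℂ (e j)] := by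
  have h := eq_neg_of_add_eq_zero_right (ExteriorAlgebra.ι_add_mul_swap (R := ℂ) (e i) (e j))
  ext a b
  fin_cases a <;> fin_cases b <;>
    simp [exteriorRep, hi, hj, h] <;> module

theorem involute_ι_mul_ι (x y : M) :
    involute (ExteriorAlgebra.ι ℂ x * ExteriorAlgebra.ι ℂ y) =
      ExteriorAlgebra.ι ℂ x * ExteriorAlgebra.ι ℂ y := by
  have h (z : M) : involute (ExteriorAlgebra.ι ℂ z) = -ExteriorAlgebra.ι ℂ z :=
    CliffordAlgebra.involute_ι z
  rw [map_mul, h, h, neg_mul_neg]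

theorem involute_list_prod_ι_mul_ι (l : List (Fin n × Fin n)) :
    involute (l.map fun p => ExteriorAlgebra.ι ℂ (e p.1) * ExteriorAlgebra.ι ℂ (e p.2)).prod =
      (l.map fun p => ExteriorAlgebra.ι ℂ (e p.1) * ExteriorAlgebra.ι ℂ (e p.2)).prod := by
  induction l with
  | nil => simp
  | cons p l ih => rw [List.map_cons, List.prod_cons, map_mul, ih, involute_ι_mul_ι]

theorem exteriorRep_list_prod (l : List (Fin n × Fin n)) (hl : ∀ p ∈ l, d p.1 = 0 ∧ d p.2 = 0) :
    ∀ q, q = (l.map fun p => ExteriorAlgebra.ι ℂ (e p.1) * ExteriorAlgebra.ι ℂ (e p.2)).prod →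
    exteriorRep e d (l.map fun p => FreeAlgebra.ι ℂ p.1 * FreeAlgebra.ι ℂ p.2 -
      FreeAlgebra.ι ℂ p.2 * FreeAlgebra.ι ℂ p.1).prod =
      (2 ^ l.length : ℂ) • !![q, (2 * l.length : ℂ) • q, 0; 0, q, 0; 0, 0, q] := by
  induction l with
  | nil =>
    rintro _ rfl
    ext a b
    fin_cases a <;> fin_cases b <;> simp
  | cons p l ih =>
    rintro _ rfl
    rw [List.map_cons, List.prod_cons, map_mul, ih (fun p hp => hl p (by simp [hp])) _ rfl,
      exteriorRep_commutator_ι e d (hl p (by simp)).1 (hl p (by simp)).2, List.map_cons,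
      List.prod_cons, smul_mul_smul_comm, List.length_cons, pow_succ']
    congr 1
    ext a b
    fin_cases a <;> fin_cases b <;>
      simp [Matrix.mul_apply, Fin.sum_univ_three]
    module

theorem exteriorRep_commutator_list_prod {i j : Fin n} (hi : d i = 1) (hj : d j = 0)
    (l : List (Fin n × Fin n)) (hl : ∀ p ∈ l, d p.1 = 0 ∧ d p.2 = 0)
    (w : FreeAlgebra ℂ (Fin n))
    (hw : w = (((i, j) :: l).map fun p => FreeAlgebra.ι ℂ p.1 * FreeAlgebra.ι ℂ p.2 -
      FreeAlgebra.ι ℂ p.2 * FreeAlgebra.ι ℂ p.1).prod) :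
    exteriorRep e d (FreeAlgebra.ι ℂ i * w - w * FreeAlgebra.ι ℂ i) 0 2 =
      (-(2 ^ (l.length + 1) * (2 * l.length + 3)) : ℂ) • (((i, j) :: l).map fun p =>
        ExteriorAlgebra.ι ℂ (e p.1) * ExteriorAlgebra.ι ℂ (e p.2)).prod := by
  have h := eq_neg_of_add_eq_zero_right (ExteriorAlgebra.ι_add_mul_swap (R := ℂ) (e i) (e j))
  have hQ := exteriorRep_list_prod e d l hl _ rfl
  have hq := mul_comm_of_involute_eq (involute_list_prod_ι_mul_ι e l) (ExteriorAlgebra.ι ℂ (e i))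
  rw [hw, List.map_cons, List.prod_cons, List.map_cons, List.prod_cons]
  generalize (l.map fun p => ExteriorAlgebra.ι ℂ (e p.1) * ExteriorAlgebra.ι ℂ (e p.2)).prod = q
    at hQ hq ⊢
  simp only [map_sub, map_mul, hQ]
  simp [exteriorRep, hi, hj, h, hq, mul_assoc]
  have h_mul (y : ExteriorAlgebra ℂ M) :
      ExteriorAlgebra.ι ℂ (e j) * (ExteriorAlgebra.ι ℂ (e i) * y) =
        -(ExteriorAlgebra.ι ℂ (e i) * (ExteriorAlgebra.ι ℂ (e j) * y)) := by
    rw [← mul_assoc, h, neg_mul, mul_assoc]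
  simp only [mul_add, add_mul, sub_mul, neg_mul, mul_assoc, h_mul]
  module

end Representation

/-- for `n = 2k`, `k ≥ 1`, the element
`v = [x_1, [x_1,x_2]·[x_3,x_4]⋯[x_{2k−1},x_{2k}]]` lies in `L_3` but not in `L_4`
(so its image in `B_3 = L_3/L_4` is nonzero). -/
theorem stmt_12 (k : ℕ) (hk : 1 ≤ k) :
    letI X : Fin (2 * k) → FreeAlgebra ℂ (Fin (2 * k)) := FreeAlgebra.ι ℂ
    letI w : FreeAlgebra ℂ (Fin (2 * k)) :=
      (List.ofFn fun j : Fin k =>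
        X ⟨2 * j.val, by have := j.2; omega⟩ * X ⟨2 * j.val + 1, by have := j.2; omega⟩
        - X ⟨2 * j.val + 1, by have := j.2; omega⟩ * X ⟨2 * j.val, by have := j.2; omega⟩).prod
    letI v : FreeAlgebra ℂ (Fin (2 * k)) :=
      X ⟨0, by omega⟩ * w - w * X ⟨0, by omega⟩
    v ∈ lcs (2 * k) 3 ∧ v ∉ lcs (2 * k) 4 := by
  obtain ⟨k, rfl⟩ : ∃ m, k = m + 1 := ⟨k - 1, by omega⟩
  let X : Fin (2 * (k + 1)) → FreeAlgebra ℂ (Fin (2 * (k + 1))) := FreeAlgebra.ι ℂ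
  let i₀ : Fin (2 * (k + 1)) := ⟨0, by omega⟩
  let i₁ : Fin (2 * (k + 1)) := ⟨1, by omega⟩
  let g : Fin (k + 1) → Fin (2 * (k + 1)) × Fin (2 * (k + 1)) := fun j =>
    (⟨2 * j.val, by have := j.2; omega⟩, ⟨2 * j.val + 1, by have := j.2; omega⟩)
  let l := List.ofFn fun j : Fin k => g j.succ
  have hg : List.ofFn g = (i₀, i₁) :: l := by rw [List.ofFn_succ]; rfl
  have hw : (List.ofFn fun j : Fin (k + 1) =>
        X (g j).1 * X (g j).2 - X (g j).2 * X (g j).1).prod =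
      (((i₀, i₁) :: l).map fun p => X p.1 * X p.2 - X p.2 * X p.1).prod := by
    rw [← hg, List.map_ofFn]
    rfl
  change X i₀ * (List.ofFn fun j : Fin (k + 1) =>
        X (g j).1 * X (g j).2 - X (g j).2 * X (g j).1).prod -
      (List.ofFn fun j : Fin (k + 1) =>
        X (g j).1 * X (g j).2 - X (g j).2 * X (g j).1).prod * X i₀ ∈ lcs (2 * (k + 1)) 3 ∧
    X i₀ * (List.ofFn fun j : Fin (k + 1) =>
        X (g j).1 * X (g j).2 - X (g j).2 * X (g j).1).prod -
      (List.ofFn fun j : Fin (k + 1) =>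
        X (g j).1 * X (g j).2 - X (g j).2 * X (g j).1).prod * X i₀ ∉ lcs (2 * (k + 1)) 4
  constructor
  · rw [hw, List.map_cons, List.prod_cons]
    refine commutator_mul_list_prod_mem_lcs_three _ _ _ _ fun u hu => ?_
    obtain ⟨p, -, rfl⟩ := List.mem_map.1 hu
    exact commutator_mem_lcs_two _ _
  · intro hv
    let e : Fin (2 * (k + 1)) → Fin (2 * (k + 1)) → ℂ := fun i => Pi.single i 1
    let d : Fin (2 * (k + 1)) → ℂ := Pi.single i₀ 1
    have hl : ∀ p ∈ l, d p.1 = 0 ∧ d p.2 = 0 := by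
      intro p hp
      obtain ⟨j, rfl⟩ := (List.mem_ofFn' _ _).1 hp
      exact ⟨Pi.single_eq_of_ne (by simp [g, i₀]) _, Pi.single_eq_of_ne (by simp [g, i₀]) _⟩
    have h₁ := exteriorRep_commutator_list_prod e d (i := i₀) (j := i₁) (Pi.single_eq_same _ _)
      (Pi.single_eq_of_ne (by simp [i₀, i₁]) _) l hl _ hw
    have h₂ := exteriorRep_of_mem_lcs_four e d hv
    rw [h₁, map_smul, involute_list_prod_ι_mul_ι, eq_neg_iff_add_eq_zero, ← add_smul, smul_eq_zero] at h₂
    rcases h₂ with h₂ | h₂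
    · rw [← neg_add, neg_eq_zero] at h₂
      norm_cast at h₂
      simp at h₂
    · refine ιMulti_pi_basis_ne_zero (2 * (k + 1)) ?_
      rw [ExteriorAlgebra.ιMulti_apply, List.ofFn_mul', List.prod_flatten, ← h₂, ← hg,
        List.map_ofFn, List.map_ofFn]
      congr 2
      ext j
      simp [e, g, List.ofFn_succ]
end
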